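/- arXiv:1410.6648 — 11 statements merged into one kernel-verified Lean document; each statement's English description precedes it below -/
import Mathlib

section
/- Let M₁ and M₂ be Kripke models, T₁ a team of M₁ and T₂ a team of M₂, and k∈ℕ. If (M₁,T₁) and (M₂,T₂) are k-bisimilar as teams, then for every MTL formula φ with md(φ)≤k, M₁,T₁⊨φ holds if and only if M₂,T₂⊨φ holds. -/
/-- A Kripke model over propositional variables `Φ` with worlds `W`. -/
structure KripkeModel (Φ : Type) (W : Type) : Type where
  nonempty : Nonempty W
  R : W → W → Prop
  val : Φ → Set W

/-- ML formulas in negation normal form. -/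
inductive MLFormula (Φ : Type) : Type
  | pos : Φ → MLFormula Φ
  | neg : Φ → MLFormula Φ
  | and : MLFormula Φ → MLFormula Φ → MLFormula Φ
  | or  : MLFormula Φ → MLFormula Φ → MLFormula Φ
  | dia : MLFormula Φ → MLFormula Φ
  | box : MLFormula Φ → MLFormula Φ

variable {Φ W W₁ W₂ : Type}

/-- Team semantics for ML. -/
def MLTeamSat (M : KripkeModel Φ W) : MLFormula Φ → Set W → Prop
  | .pos p, T => T ⊆ M.val p
  | .neg p, T => T ∩ M.val p = ∅
  | .and φ ψ, T => MLTeamSat M φ T ∧ MLTeamSat M ψ T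
  | .or φ ψ, T => ∃ T₁ T₂, T = T₁ ∪ T₂ ∧ MLTeamSat M φ T₁ ∧ MLTeamSat M ψ T₂
  | .dia φ, T => ∃ T', MLTeamSat M φ T' ∧ (∀ w ∈ T, ∃ w' ∈ T', M.R w w') ∧
      (∀ w' ∈ T', ∃ w ∈ T, M.R w w')
  | .box φ, T => MLTeamSat M φ {w' | ∃ w ∈ T, M.R w w'}

/-- Standard single-world Kripke semantics for ML. -/
def MLWorldSat (M : KripkeModel Φ W) : MLFormula Φ → W → Prop
  | .pos p, w => w ∈ M.val p
  | .neg p, w => w ∉ M.val p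
  | .and φ ψ, w => MLWorldSat M φ w ∧ MLWorldSat M ψ w
  | .or φ ψ, w => MLWorldSat M φ w ∨ MLWorldSat M ψ w
  | .dia φ, w => ∃ w', M.R w w' ∧ MLWorldSat M φ w'
  | .box φ, w => ∀ w', M.R w w' → MLWorldSat M φ w'

/-- Modal depth of an ML formula. -/
def MLmd : MLFormula Φ → ℕ
  | .pos _ => 0
  | .neg _ => 0
  | .and φ ψ => max (MLmd φ) (MLmd ψ)
  | .or φ ψ => max (MLmd φ) (MLmd ψ)
  | .dia φ => MLmd φ + 1
  | .box φ => MLmd φ + 1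

/-- `k`-bisimilarity of pointed Kripke models. -/
def kBisim (M₁ : KripkeModel Φ W₁) (M₂ : KripkeModel Φ W₂) : ℕ → W₁ → W₂ → Prop
  | 0, w₁, w₂ => ∀ p, w₁ ∈ M₁.val p ↔ w₂ ∈ M₂.val p
  | k+1, w₁, w₂ => (∀ p, w₁ ∈ M₁.val p ↔ w₂ ∈ M₂.val p)
      ∧ (∀ w₁', M₁.R w₁ w₁' → ∃ w₂', M₂.R w₂ w₂' ∧ kBisim M₁ M₂ k w₁' w₂')
      ∧ (∀ w₂', M₂.R w₂ w₂' → ∃ w₁', M₁.R w₁ w₁' ∧ kBisim M₁ M₂ k w₁' w₂')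

/-- `k`-bisimilarity of teams. -/
def teamKBisim (M₁ : KripkeModel Φ W₁) (M₂ : KripkeModel Φ W₂) (k : ℕ)
    (T₁ : Set W₁) (T₂ : Set W₂) : Prop :=
  (∀ w₁ ∈ T₁, ∃ w₂ ∈ T₂, kBisim M₁ M₂ k w₁ w₂) ∧
  (∀ w₂ ∈ T₂, ∃ w₁ ∈ T₁, kBisim M₁ M₂ k w₁ w₂)

/-- Full team bisimilarity. -/
def teamBisim (M₁ : KripkeModel Φ W₁) (M₂ : KripkeModel Φ W₂)
    (T₁ : Set W₁) (T₂ : Set W₂) : Prop :=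
  ∃ Z : W₁ → W₂ → Prop,
    (∀ w₁ w₂, Z w₁ w₂ →
      (∀ p, w₁ ∈ M₁.val p ↔ w₂ ∈ M₂.val p)
      ∧ (∀ w₁', M₁.R w₁ w₁' → ∃ w₂', M₂.R w₂ w₂' ∧ Z w₁' w₂')
      ∧ (∀ w₂', M₂.R w₂ w₂' → ∃ w₁', M₁.R w₁ w₁' ∧ Z w₁' w₂')) ∧
    (∀ w₁ ∈ T₁, ∃ w₂ ∈ T₂, Z w₁ w₂) ∧
    (∀ w₂ ∈ T₂, ∃ w₁ ∈ T₁, Z w₁ w₂)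

/-- MTL formulas: ML plus classical negation `∼`. -/
inductive MTLFormula (Φ : Type) : Type
  | pos : Φ → MTLFormula Φ
  | neg : Φ → MTLFormula Φ
  | cneg : MTLFormula Φ → MTLFormula Φ
  | and : MTLFormula Φ → MTLFormula Φ → MTLFormula Φ
  | or  : MTLFormula Φ → MTLFormula Φ → MTLFormula Φ
  | dia : MTLFormula Φ → MTLFormula Φ
  | box : MTLFormula Φ → MTLFormula Φ

/-- Team semantics for MTL. -/
def MTLTeamSat (M : KripkeModel Φ W) : MTLFormula Φ → Set W → Prop
  | .pos p, T => T ⊆ M.val p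
  | .neg p, T => T ∩ M.val p = ∅
  | .cneg φ, T => ¬ MTLTeamSat M φ T
  | .and φ ψ, T => MTLTeamSat M φ T ∧ MTLTeamSat M ψ T
  | .or φ ψ, T => ∃ T₁ T₂, T = T₁ ∪ T₂ ∧ MTLTeamSat M φ T₁ ∧ MTLTeamSat M ψ T₂
  | .dia φ, T => ∃ T', MTLTeamSat M φ T' ∧ (∀ w ∈ T, ∃ w' ∈ T', M.R w w') ∧
      (∀ w' ∈ T', ∃ w ∈ T, M.R w w')
  | .box φ, T => MTLTeamSat M φ {w' | ∃ w ∈ T, M.R w w'}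

/-- Modal depth of an MTL formula. -/
def MTLmd : MTLFormula Φ → ℕ
  | .pos _ => 0
  | .neg _ => 0
  | .cneg φ => MTLmd φ
  | .and φ ψ => max (MTLmd φ) (MTLmd ψ)
  | .or φ ψ => max (MTLmd φ) (MTLmd ψ)
  | .dia φ => MTLmd φ + 1
  | .box φ => MTLmd φ + 1

theorem kBisim.mem_val_iff {M₁ : KripkeModel Φ W₁} {M₂ : KripkeModel Φ W₂} {k : ℕ}
    {w₁ : W₁} {w₂ : W₂} (h : kBisim M₁ M₂ k w₁ w₂) (p : Φ) :
    w₁ ∈ M₁.val p ↔ w₂ ∈ M₂.val p := by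
  cases k with
  | zero => exact h p
  | succ k => exact h.1 p

theorem kBisim.symm {M₁ : KripkeModel Φ W₁} {M₂ : KripkeModel Φ W₂} {k : ℕ}
    {w₁ : W₁} {w₂ : W₂} (h : kBisim M₁ M₂ k w₁ w₂) : kBisim M₂ M₁ k w₂ w₁ := by
  induction k generalizing w₁ w₂ with
  | zero => exact fun p => (h p).symm
  | succ k ih =>
    obtain ⟨hval, hforth, hback⟩ := h
    refine ⟨fun p => (hval p).symm, fun v₂ hv₂ => ?_, fun v₁ hv₁ => ?_⟩
    · obtain ⟨v₁, hR, hv⟩ := hback v₂ hv₂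
      exact ⟨v₁, hR, ih hv⟩
    · obtain ⟨v₂, hR, hv⟩ := hforth v₁ hv₁
      exact ⟨v₂, hR, ih hv⟩

namespace teamKBisim

variable {M₁ : KripkeModel Φ W₁} {M₂ : KripkeModel Φ W₂} {k : ℕ} {T₁ : Set W₁} {T₂ : Set W₂}

theorem symm (h : teamKBisim M₁ M₂ k T₁ T₂) : teamKBisim M₂ M₁ k T₂ T₁ := by
  refine ⟨fun w₂ hw₂ => ?_, fun w₁ hw₁ => ?_⟩
  · obtain ⟨w₁, hw₁, hw⟩ := h.2 w₂ hw₂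
    exact ⟨w₁, hw₁, hw.symm⟩
  · obtain ⟨w₂, hw₂, hw⟩ := h.1 w₁ hw₁
    exact ⟨w₂, hw₂, hw.symm⟩

theorem exists_eq_union {A₁ B₁ : Set W₁} (h : teamKBisim M₁ M₂ k (A₁ ∪ B₁) T₂) :
    ∃ A₂ B₂, T₂ = A₂ ∪ B₂ ∧ teamKBisim M₁ M₂ k A₁ A₂ ∧ teamKBisim M₁ M₂ k B₁ B₂ := by
  refine ⟨{w₂ ∈ T₂ | ∃ w₁ ∈ A₁, kBisim M₁ M₂ k w₁ w₂},
    {w₂ ∈ T₂ | ∃ w₁ ∈ B₁, kBisim M₁ M₂ k w₁ w₂}, Set.Subset.antisymm (fun w₂ hw₂ => ?_) ?_,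
    ⟨fun w₁ hw₁ => ?_, fun _ hw₂ => hw₂.2⟩, ⟨fun w₁ hw₁ => ?_, fun _ hw₂ => hw₂.2⟩⟩
  · obtain ⟨w₁, hw₁ | hw₁, hw⟩ := h.2 w₂ hw₂
    · exact Or.inl ⟨hw₂, w₁, hw₁, hw⟩
    · exact Or.inr ⟨hw₂, w₁, hw₁, hw⟩
  · exact Set.union_subset (Set.sep_subset _ _) (Set.sep_subset _ _)
  · obtain ⟨w₂, hw₂, hw⟩ := h.1 w₁ (Or.inl hw₁)
    exact ⟨w₂, ⟨hw₂, w₁, hw₁, hw⟩, hw⟩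
  · obtain ⟨w₂, hw₂, hw⟩ := h.1 w₁ (Or.inr hw₁)
    exact ⟨w₂, ⟨hw₂, w₁, hw₁, hw⟩, hw⟩

theorem exists_successor_team (h : teamKBisim M₁ M₂ (k + 1) T₁ T₂) {S₁ : Set W₁}
    (hforth : ∀ w ∈ T₁, ∃ v ∈ S₁, M₁.R w v) (hback : ∀ v ∈ S₁, ∃ w ∈ T₁, M₁.R w v) :
    ∃ S₂, teamKBisim M₁ M₂ k S₁ S₂ ∧ (∀ w ∈ T₂, ∃ v ∈ S₂, M₂.R w v) ∧
      (∀ v ∈ S₂, ∃ w ∈ T₂, M₂.R w v) := by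
  refine ⟨{v₂ | (∃ w₂ ∈ T₂, M₂.R w₂ v₂) ∧ ∃ v₁ ∈ S₁, kBisim M₁ M₂ k v₁ v₂},
    ⟨fun v₁ hv₁ => ?_, fun _ hv₂ => hv₂.2⟩, fun w₂ hw₂ => ?_, fun _ hv₂ => hv₂.1⟩
  · obtain ⟨w₁, hw₁, hR₁⟩ := hback v₁ hv₁
    obtain ⟨w₂, hw₂, hw⟩ := h.1 w₁ hw₁
    obtain ⟨v₂, hR₂, hv⟩ := hw.2.1 v₁ hR₁
    exact ⟨v₂, ⟨⟨w₂, hw₂, hR₂⟩, v₁, hv₁, hv⟩, hv⟩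
  · obtain ⟨w₁, hw₁, hw⟩ := h.2 w₂ hw₂
    obtain ⟨v₁, hv₁, hR₁⟩ := hforth w₁ hw₁
    obtain ⟨v₂, hR₂, hv⟩ := hw.2.1 v₁ hR₁
    exact ⟨v₂, ⟨⟨w₂, hw₂, hR₂⟩, v₁, hv₁, hv⟩, hR₂⟩

theorem image (h : teamKBisim M₁ M₂ (k + 1) T₁ T₂) :
    teamKBisim M₁ M₂ k {v | ∃ w ∈ T₁, M₁.R w v} {v | ∃ w ∈ T₂, M₂.R w v} := by
  constructor
  · rintro v₁ ⟨w₁, hw₁, hR₁⟩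
    obtain ⟨w₂, hw₂, hw⟩ := h.1 w₁ hw₁
    obtain ⟨v₂, hR₂, hv⟩ := hw.2.1 v₁ hR₁
    exact ⟨v₂, ⟨w₂, hw₂, hR₂⟩, hv⟩
  · rintro v₂ ⟨w₂, hw₂, hR₂⟩
    obtain ⟨w₁, hw₁, hw⟩ := h.2 w₂ hw₂
    obtain ⟨v₁, hR₁, hv⟩ := hw.2.2 v₂ hR₂
    exact ⟨v₁, ⟨w₁, hw₁, hR₁⟩, hv⟩

end teamKBisim

/-- Stated in one direction, for arbitrary models, so that the converse follows by symmetry. -/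
theorem MTLTeamSat.of_teamKBisim {φ : MTLFormula Φ} {V₁ V₂ : Type}
    {M₁ : KripkeModel Φ V₁} {M₂ : KripkeModel Φ V₂} {k : ℕ} {T₁ : Set V₁} {T₂ : Set V₂}
    (hsat : MTLTeamSat M₁ φ T₁) (h : teamKBisim M₁ M₂ k T₁ T₂) (hφ : MTLmd φ ≤ k) :
    MTLTeamSat M₂ φ T₂ := by
  induction φ generalizing V₁ V₂ k with
  | pos p =>
    intro w₂ hw₂
    obtain ⟨w₁, hw₁, hw⟩ := h.2 w₂ hw₂
    exact (hw.mem_val_iff p).1 (hsat hw₁)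
  | neg p =>
    refine Set.eq_empty_iff_forall_notMem.2 fun w₂ hw₂ => ?_
    obtain ⟨w₁, hw₁, hw⟩ := h.2 w₂ hw₂.1
    exact Set.eq_empty_iff_forall_notMem.1 hsat w₁ ⟨hw₁, (hw.mem_val_iff p).2 hw₂.2⟩
  | cneg φ ih => exact fun hsat₂ => hsat (ih hsat₂ h.symm hφ)
  | and φ ψ ihφ ihψ =>
    have hmd := max_le_iff.1 hφ
    exact ⟨ihφ hsat.1 h hmd.1, ihψ hsat.2 h hmd.2⟩
  | or φ ψ ihφ ihψ =>
    have hmd := max_le_iff.1 hφ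
    obtain ⟨A₁, B₁, rfl, hA₁, hB₁⟩ := hsat
    obtain ⟨A₂, B₂, hT₂, hA, hB⟩ := h.exists_eq_union
    exact ⟨A₂, B₂, hT₂, ihφ hA₁ hA hmd.1, ihψ hB₁ hB hmd.2⟩
  | dia φ ih =>
    obtain _ | k := k
    · exact absurd hφ (Nat.not_succ_le_zero _)
    obtain ⟨S₁, hS₁, hforth, hback⟩ := hsat
    obtain ⟨S₂, hS, hforth₂, hback₂⟩ := h.exists_successor_team hforth hback
    exact ⟨S₂, ih hS₁ hS (Nat.le_of_succ_le_succ hφ), hforth₂, hback₂⟩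
  | box φ ih =>
    obtain _ | k := k
    · exact absurd hφ (Nat.not_succ_le_zero _)
    exact ih hsat h.image (Nat.le_of_succ_le_succ hφ)

/-- If two teams are `k`-bisimilar, then they satisfy the same MTL formulas of modal
depth at most `k`. -/
theorem teamKBisim_MTL_invariance (M₁ : KripkeModel Φ W₁) (M₂ : KripkeModel Φ W₂)
    (T₁ : Set W₁) (T₂ : Set W₂) (k : ℕ) (h : teamKBisim M₁ M₂ k T₁ T₂)
    (φ : MTLFormula Φ) (hφ : MTLmd φ ≤ k) :
    MTLTeamSat M₁ φ T₁ ↔ MTLTeamSat M₂ φ T₂ :=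
  ⟨fun hsat => hsat.of_teamKBisim h hφ, fun hsat => hsat.of_teamKBisim h.symm hφ⟩
end

section
/- Let M₁ and M₂ be Kripke models, T₁ a team of M₁ and T₂ a team of M₂. If (M₁,T₁) and (M₂,T₂) are (fully) team-bisimilar, then for every MTL formula φ, M₁,T₁⊨φ holds if and only if M₂,T₂⊨φ holds. -/
variable {Φ W W₁ W₂ : Type}

theorem teamBisim.symm {M₁ : KripkeModel Φ W₁} {M₂ : KripkeModel Φ W₂}
    {T₁ : Set W₁} {T₂ : Set W₂} (h : teamBisim M₁ M₂ T₁ T₂) : teamBisim M₂ M₁ T₂ T₁ := by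
  obtain ⟨Z, hZ, hforth, hback⟩ := h
  refine ⟨fun w₂ w₁ => Z w₁ w₂, fun w₂ w₁ hw => ?_, hback, hforth⟩
  obtain ⟨hval, hR₁, hR₂⟩ := hZ w₁ w₂ hw
  exact ⟨fun p => (hval p).symm, hR₂, hR₁⟩

theorem teamBisim.subset_val {M₁ : KripkeModel Φ W₁} {M₂ : KripkeModel Φ W₂}
    {T₁ : Set W₁} {T₂ : Set W₂} (h : teamBisim M₁ M₂ T₁ T₂) {p : Φ} (hp : T₁ ⊆ M₁.val p) :
    T₂ ⊆ M₂.val p := by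
  obtain ⟨Z, hZ, -, hback⟩ := h
  intro w₂ hw₂
  obtain ⟨w₁, hw₁, hw⟩ := hback w₂ hw₂
  exact ((hZ w₁ w₂ hw).1 p).1 (hp hw₁)

theorem teamBisim.inter_val_eq_empty {M₁ : KripkeModel Φ W₁} {M₂ : KripkeModel Φ W₂}
    {T₁ : Set W₁} {T₂ : Set W₂} (h : teamBisim M₁ M₂ T₁ T₂) {p : Φ}
    (hp : T₁ ∩ M₁.val p = ∅) : T₂ ∩ M₂.val p = ∅ := by
  obtain ⟨Z, hZ, -, hback⟩ := h
  refine Set.eq_empty_of_forall_notMem fun w₂ ⟨hw₂, hpw₂⟩ => ?_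
  obtain ⟨w₁, hw₁, hw⟩ := hback w₂ hw₂
  exact Set.eq_empty_iff_forall_notMem.1 hp w₁ ⟨hw₁, ((hZ w₁ w₂ hw).1 p).2 hpw₂⟩

/-- Team bisimilarity transfers splittings of a team. -/
theorem teamBisim.exists_union {M₁ : KripkeModel Φ W₁} {M₂ : KripkeModel Φ W₂}
    {A B : Set W₁} {T₂ : Set W₂} (h : teamBisim M₁ M₂ (A ∪ B) T₂) :
    ∃ A' B', T₂ = A' ∪ B' ∧ teamBisim M₁ M₂ A A' ∧ teamBisim M₁ M₂ B B' := by
  obtain ⟨Z, hZ, hforth, hback⟩ := h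
  have image_bisim : ∀ S ⊆ A ∪ B, teamBisim M₁ M₂ S {w₂ ∈ T₂ | ∃ w₁ ∈ S, Z w₁ w₂} := by
    refine fun S hS => ⟨Z, hZ, fun w₁ hw₁ => ?_, fun w₂ hw₂ => hw₂.2⟩
    obtain ⟨w₂, hw₂, hw⟩ := hforth w₁ (hS hw₁)
    exact ⟨w₂, ⟨hw₂, w₁, hw₁, hw⟩, hw⟩
  refine ⟨_, _, ?_, image_bisim A Set.subset_union_left, image_bisim B Set.subset_union_right⟩
  ext w₂
  refine ⟨fun hw₂ => ?_, fun hw₂ => hw₂.elim And.left And.left⟩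
  obtain ⟨w₁, hw₁ | hw₁, hw⟩ := hback w₂ hw₂
  · exact Or.inl ⟨hw₂, w₁, hw₁, hw⟩
  · exact Or.inr ⟨hw₂, w₁, hw₁, hw⟩

/-- Team bisimilarity transfers successor teams in the sense of `◇`. -/
theorem teamBisim.exists_successor {M₁ : KripkeModel Φ W₁} {M₂ : KripkeModel Φ W₂}
    {T₁ T₁' : Set W₁} {T₂ : Set W₂} (h : teamBisim M₁ M₂ T₁ T₂)
    (hsucc : ∀ w ∈ T₁, ∃ w' ∈ T₁', M₁.R w w') (hpred : ∀ w' ∈ T₁', ∃ w ∈ T₁, M₁.R w w') :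
    ∃ T₂', teamBisim M₁ M₂ T₁' T₂' ∧ (∀ w ∈ T₂, ∃ w' ∈ T₂', M₂.R w w') ∧
      (∀ w' ∈ T₂', ∃ w ∈ T₂, M₂.R w w') := by
  obtain ⟨Z, hZ, hforth, hback⟩ := h
  refine ⟨{v₂ | (∃ w₂ ∈ T₂, M₂.R w₂ v₂) ∧ ∃ v₁ ∈ T₁', Z v₁ v₂},
    ⟨Z, hZ, fun v₁ hv₁ => ?_, fun v₂ hv₂ => hv₂.2⟩, fun w₂ hw₂ => ?_, fun v₂ hv₂ => hv₂.1⟩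
  · obtain ⟨w₁, hw₁, hR₁⟩ := hpred v₁ hv₁
    obtain ⟨w₂, hw₂, hw⟩ := hforth w₁ hw₁
    obtain ⟨v₂, hR₂, hv⟩ := (hZ w₁ w₂ hw).2.1 v₁ hR₁
    exact ⟨v₂, ⟨⟨w₂, hw₂, hR₂⟩, v₁, hv₁, hv⟩, hv⟩
  · obtain ⟨w₁, hw₁, hw⟩ := hback w₂ hw₂
    obtain ⟨v₁, hv₁, hR₁⟩ := hsucc w₁ hw₁
    obtain ⟨v₂, hR₂, hv⟩ := (hZ w₁ w₂ hw).2.1 v₁ hR₁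
    exact ⟨v₂, ⟨⟨w₂, hw₂, hR₂⟩, v₁, hv₁, hv⟩, hR₂⟩

/-- Team bisimilarity passes to the teams of all successors. -/
theorem teamBisim.image {M₁ : KripkeModel Φ W₁} {M₂ : KripkeModel Φ W₂}
    {T₁ : Set W₁} {T₂ : Set W₂} (h : teamBisim M₁ M₂ T₁ T₂) :
    teamBisim M₁ M₂ {w' | ∃ w ∈ T₁, M₁.R w w'} {w' | ∃ w ∈ T₂, M₂.R w w'} := by
  obtain ⟨Z, hZ, hforth, hback⟩ := h
  refine ⟨Z, hZ, fun v₁ ⟨w₁, hw₁, hR₁⟩ => ?_, fun v₂ ⟨w₂, hw₂, hR₂⟩ => ?_⟩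
  · obtain ⟨w₂, hw₂, hw⟩ := hforth w₁ hw₁
    obtain ⟨v₂, hR₂, hv⟩ := (hZ w₁ w₂ hw).2.1 v₁ hR₁
    exact ⟨v₂, ⟨w₂, hw₂, hR₂⟩, hv⟩
  · obtain ⟨w₁, hw₁, hw⟩ := hback w₂ hw₂
    obtain ⟨v₁, hR₁, hv⟩ := (hZ w₁ w₂ hw).2.2 v₂ hR₂
    exact ⟨v₁, ⟨w₁, hw₁, hR₁⟩, hv⟩

/-- If two teams are fully team-bisimilar, then they satisfy the same MTL formulas. -/
theorem teamBisim_MTL_invariance (M₁ : KripkeModel Φ W₁) (M₂ : KripkeModel Φ W₂)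
    (T₁ : Set W₁) (T₂ : Set W₂) (h : teamBisim M₁ M₂ T₁ T₂) (φ : MTLFormula Φ) :
    MTLTeamSat M₁ φ T₁ ↔ MTLTeamSat M₂ φ T₂ := by
  induction φ generalizing T₁ T₂ with
  | pos p => exact ⟨h.subset_val, h.symm.subset_val⟩
  | neg p => exact ⟨h.inter_val_eq_empty, h.symm.inter_val_eq_empty⟩
  | cneg φ ih => exact not_congr (ih T₁ T₂ h)
  | and φ ψ ihφ ihψ => exact and_congr (ihφ T₁ T₂ h) (ihψ T₁ T₂ h)
  | or φ ψ ihφ ihψ =>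
    constructor
    · rintro ⟨A, B, rfl, hA, hB⟩
      obtain ⟨A', B', hT, hAA', hBB'⟩ := h.exists_union
      exact ⟨A', B', hT, (ihφ A A' hAA').1 hA, (ihψ B B' hBB').1 hB⟩
    · rintro ⟨A, B, rfl, hA, hB⟩
      obtain ⟨A', B', hT, hAA', hBB'⟩ := h.symm.exists_union
      exact ⟨A', B', hT, (ihφ A' A hAA'.symm).2 hA, (ihψ B' B hBB'.symm).2 hB⟩
  | dia φ ih =>
    constructor
    · rintro ⟨T₁', hφ, hsucc, hpred⟩
      obtain ⟨T₂', hT', hT₂⟩ := h.exists_successor hsucc hpred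
      exact ⟨T₂', (ih T₁' T₂' hT').1 hφ, hT₂⟩
    · rintro ⟨T₂', hφ, hsucc, hpred⟩
      obtain ⟨T₁', hT', hT₁⟩ := h.symm.exists_successor hsucc hpred
      exact ⟨T₁', (ih T₁' T₂' hT'.symm).2 hφ, hT₁⟩
  | box φ ih => exact ih _ _ h.image
end

section
/- Let S be a nonempty finite set (or list) of ML formulas, M a Kripke model and T a team of M. Then M,T⊨⋁_{φ∈S}φ, where ⋁ denotes the iterated splitting disjunction ∨ over the members of S, if and only if for each world w∈T there is some formula φ∈S with M,{w}⊨φ. -/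
variable {Φ W W₁ W₂ : Type}

/-- Flatness of ML: a team satisfies a formula iff each of its worlds does. -/
theorem MLTeamSat_iff_forall_MLWorldSat (M : KripkeModel Φ W) (φ : MLFormula Φ) (T : Set W) :
    MLTeamSat M φ T ↔ ∀ w ∈ T, MLWorldSat M φ w := by
  induction φ generalizing T with
  | pos p => exact Iff.rfl
  | neg p =>
    simp only [MLTeamSat, MLWorldSat, Set.eq_empty_iff_forall_notMem, Set.mem_inter_iff, not_and]
  | and φ ψ ihφ ihψ =>
    simp only [MLTeamSat, MLWorldSat, ihφ, ihψ]
    exact ⟨fun h w hw => ⟨h.1 w hw, h.2 w hw⟩, fun h => ⟨fun w hw => (h w hw).1,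
      fun w hw => (h w hw).2⟩⟩
  | or φ ψ ihφ ihψ =>
    simp only [MLTeamSat, MLWorldSat, ihφ, ihψ]
    constructor
    · rintro ⟨T₁, T₂, rfl, h₁, h₂⟩ w (hw | hw)
      · exact Or.inl (h₁ w hw)
      · exact Or.inr (h₂ w hw)
    · intro h
      refine ⟨{w ∈ T | MLWorldSat M φ w}, {w ∈ T | MLWorldSat M ψ w}, ?_,
        fun w hw => hw.2, fun w hw => hw.2⟩
      ext w
      exact ⟨fun hw => (h w hw).imp (⟨hw, ·⟩) (⟨hw, ·⟩), fun hw => hw.elim And.left And.left⟩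
  | dia φ ih =>
    simp only [MLTeamSat, MLWorldSat, ih]
    constructor
    · rintro ⟨T', hT', hforth, -⟩ w hw
      obtain ⟨w', hw', hR⟩ := hforth w hw
      exact ⟨w', hR, hT' w' hw'⟩
    · intro h
      refine ⟨{w' | MLWorldSat M φ w' ∧ ∃ w ∈ T, M.R w w'}, fun w hw => hw.1, ?_,
        fun w hw => hw.2⟩
      intro w hw
      obtain ⟨w', hR, hw'⟩ := h w hw
      exact ⟨w', ⟨hw', w, hw, hR⟩, hR⟩
  | box φ ih =>
    simp only [MLTeamSat, MLWorldSat, ih]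
    exact ⟨fun h w hw w' hR => h w' ⟨w, hw, hR⟩, fun h w' ⟨w, hw, hR⟩ => h w hw w' hR⟩

theorem MLWorldSat_foldl_or (M : KripkeModel Φ W) (φ₀ : MLFormula Φ) (S : List (MLFormula Φ))
    (w : W) :
    MLWorldSat M (S.foldl MLFormula.or φ₀) w ↔ ∃ ψ ∈ φ₀ :: S, MLWorldSat M ψ w := by
  induction S generalizing φ₀ with
  | nil => simp
  | cons φ S ih =>
    rw [List.foldl_cons, ih]
    simp only [List.exists_mem_cons_iff, MLWorldSat, or_assoc]

/-- Characterization of the iterated splitting disjunction of a nonempty finite list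
`φ₀ :: S` of ML formulas: a team satisfies it iff every world of the team satisfies
some member in the singleton team sense. -/
theorem bigSplitjunction_characterization (M : KripkeModel Φ W) (T : Set W)
    (φ₀ : MLFormula Φ) (S : List (MLFormula Φ)) :
    MLTeamSat M (S.foldl MLFormula.or φ₀) T ↔
      ∀ w ∈ T, ∃ ψ ∈ φ₀ :: S, MLTeamSat M ψ {w} := by
  simp only [MLTeamSat_iff_forall_MLWorldSat, MLWorldSat_foldl_or, Set.mem_singleton_iff,
    forall_eq]
end

section
/- Let Φ be a finite set of propositional variables and k∈ℕ. Then there are only finitely many pointed Kripke models up to k-bisimulation: there exists a finite list of pointed Kripke models (each with a finite set of worlds) such that every pointed Kripke model over Φ is k-bisimilar to some member of the list. -/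
variable {Φ W W₁ W₂ : Type}

/-- The model obtained from `N` by adding, for every set `s` of variables and every set `T` of
worlds of `N`, a new world satisfying exactly `s` whose successors are exactly the worlds in `T`. -/
def KripkeModel.addRoots (N : KripkeModel Φ W) : KripkeModel Φ ((Set Φ × Set W) ⊕ W) where
  nonempty := N.nonempty.map Sum.inr
  R
    | .inl (_, T), .inr v => v ∈ T
    | .inr u, .inr v => N.R u v
    | _, .inl _ => False
  val p := {x | Sum.elim (fun a => p ∈ a.1) (fun v => v ∈ N.val p) x}

theorem kBisim_addRoots_inr {M : KripkeModel Φ W₁} {N : KripkeModel Φ W₂} {k : ℕ} {w : W₁}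
    {v : W₂} (h : kBisim M N k w v) : kBisim M N.addRoots k w (.inr v) := by
  induction k generalizing w v with
  | zero => exact h
  | succ k ih =>
    obtain ⟨hval, hforth, hback⟩ := h
    refine ⟨hval, fun w' hw' => ?_, ?_⟩
    · obtain ⟨v', hv', h'⟩ := hforth w' hw'
      exact ⟨.inr v', hv', ih h'⟩
    · rintro (_ | v') hv'
      · exact hv'.elim
      · obtain ⟨w', hw', h'⟩ := hback v' hv'
        exact ⟨w', hw', ih h'⟩

/-- If every world of `M` is `k`-bisimilar to a world of `N`, then every world of `M` is
`(k + 1)`-bisimilar to one of the worlds added in `N.addRoots`. -/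
theorem kBisim_succ_addRoots {M : KripkeModel Φ W₁} {N : KripkeModel Φ W₂} {k : ℕ}
    (h : ∀ w, ∃ v, kBisim M N k w v) (w : W₁) :
    kBisim M N.addRoots (k + 1) w
      (.inl ({p | w ∈ M.val p}, {v | ∃ w', M.R w w' ∧ kBisim M N k w' v})) := by
  refine ⟨fun _ => Iff.rfl, fun w' hw' => ?_, ?_⟩
  · obtain ⟨v, hv⟩ := h w'
    exact ⟨.inr v, ⟨w', hw', hv⟩, kBisim_addRoots_inr hv⟩
  · rintro (_ | v) hv
    · exact hv.elim
    · obtain ⟨w', hw', h'⟩ := hv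
      exact ⟨w', hw', kBisim_addRoots_inr h'⟩

/-- Some finite model realizes every pointed model up to `k`-bisimilarity. -/
theorem exists_finite_kBisim_universal (Φ : Type) [Finite Φ] (k : ℕ) :
    ∃ (V : Type) (_ : Finite V) (N : KripkeModel Φ V),
      ∀ (W : Type) (M : KripkeModel Φ W) (w : W), ∃ v, kBisim M N k w v := by
  induction k with
  | zero =>
    exact ⟨Set Φ, inferInstance, ⟨⟨∅⟩, fun _ _ => False, fun p => {s | p ∈ s}⟩,
      fun W M w => ⟨{p | w ∈ M.val p}, fun _ => Iff.rfl⟩⟩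
  | succ k ih =>
    obtain ⟨V, _, N, hN⟩ := ih
    exact ⟨_, inferInstance, N.addRoots, fun W M w => ⟨_, kBisim_succ_addRoots (hN W M) w⟩⟩

/-- Over a finite set of propositional variables, there are only finitely many pointed
Kripke models up to `k`-bisimulation: there is a finite list of pointed models with
finite sets of worlds such that every pointed model is `k`-bisimilar to a member. -/
theorem finitely_many_kBisim_classes [Finite Φ] (k : ℕ) :
    ∃ L : List (Σ W : Type, KripkeModel Φ W × W),
      (∀ x ∈ L, Finite x.1) ∧
      ∀ (W : Type) (M : KripkeModel Φ W) (w : W),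
        ∃ x ∈ L, kBisim M x.2.1 k w x.2.2 := by
  obtain ⟨V, _, N, hN⟩ := exists_finite_kBisim_universal Φ k
  have := Fintype.ofFinite V
  refine ⟨Finset.univ.toList.map fun v => ⟨V, N, v⟩, by simp [‹Finite V›], fun W M w => ?_⟩
  obtain ⟨v, hv⟩ := hN W M w
  exact ⟨⟨V, N, v⟩, by simp, hv⟩
end

section
/- Let Φ be a finite set of propositional variables and let P be a team property (a collection of pairs (M,T) with T a nonempty team of M). If P is invariant under k-bisimulation for some k∈ℕ, then there exists a first-order sentence ψ over the signature σ_Φ such that for all Kripke models M and nonempty teams T: (M,T)∈P if and only if the first-order structure A(M,T) satisfies ψ. -/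
variable {Φ W W₁ W₂ : Type}

/-- Relation symbols of the first-order signature `σ_Φ`: one unary symbol for the team
(`Option.none`), one unary symbol `W_p` for each `p ∈ Φ` (`Option.some p`), and one
binary symbol `E` for the accessibility relation. -/
def sigmaRel (Φ : Type) : ℕ → Type
  | 1 => Option Φ
  | 2 => Unit
  | _ => Empty

/-- The first-order signature `σ_Φ`. -/
def sigmaLang (Φ : Type) : FirstOrder.Language where
  Functions := fun _ => Empty
  Relations := sigmaRel Φ

/-- The `σ_Φ`-structure `A(M,T)` determined by a Kripke model `M` and a team `T`. -/
def foStruct (M : KripkeModel Φ W) (T : Set W) : (sigmaLang Φ).Structure W where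
  funMap := fun {n} f _ => (f : Empty).elim
  RelMap := fun {n} => match n with
    | 1 => fun r xs => match r with
      | Option.none => xs 0 ∈ T
      | Option.some p => xs 0 ∈ M.val p
    | 2 => fun _ xs => M.R (xs 0) (xs 1)
    | 0 => fun r _ => (r : Empty).elim
    | (_+3) => fun r _ => (r : Empty).elim

/-- Satisfaction of a `σ_Φ`-sentence in `A(M,T)`. -/
def foSat (M : KripkeModel Φ W) (T : Set W) (ψ : (sigmaLang Φ).Sentence) : Prop :=
  @FirstOrder.Language.Sentence.Realize (sigmaLang Φ) W (foStruct M T) ψ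

open FirstOrder Language in
/-- A property of tuples of worlds of Kripke models with teams is first-order definable if some
`σ_Φ`-formula defines it uniformly in all the structures `A(M,T)`. -/
def FODefinable (n : ℕ) (Q : ∀ W : Type, KripkeModel Φ W → Set W → (Fin n → W) → Prop) : Prop :=
  ∃ χ : (sigmaLang Φ).BoundedFormula Empty n,
    ∀ (W : Type) (M : KripkeModel Φ W) (T : Set W) (xs : Fin n → W),
      @BoundedFormula.Realize (sigmaLang Φ) W (foStruct M T) Empty n χ default xs ↔ Q W M T xs

namespace FODefinable

open FirstOrder Language

variable {n : ℕ} {Q Q' : ∀ W : Type, KripkeModel Φ W → Set W → (Fin n → W) → Prop}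

theorem val (p : Φ) (i : Fin n) : FODefinable n fun _ M _ xs => xs i ∈ M.val p := by
  refine ⟨Relations.boundedFormula₁ (L := sigmaLang Φ) (some p : Option Φ) (Term.var (Sum.inr i)),
    fun W M T xs => ?_⟩
  let := foStruct M T
  exact BoundedFormula.realize_rel₁

theorem team (i : Fin n) : FODefinable (Φ := Φ) n fun _ _ T xs => xs i ∈ T := by
  refine ⟨Relations.boundedFormula₁ (L := sigmaLang Φ) (none : Option Φ) (Term.var (Sum.inr i)),
    fun W M T xs => ?_⟩
  let := foStruct M T
  exact BoundedFormula.realize_rel₁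

theorem rel (i j : Fin n) : FODefinable (Φ := Φ) n fun _ M _ xs => M.R (xs i) (xs j) := by
  refine ⟨Relations.boundedFormula₂ (L := sigmaLang Φ) () (Term.var (Sum.inr i))
    (Term.var (Sum.inr j)), fun W M T xs => ?_⟩
  let := foStruct M T
  exact BoundedFormula.realize_rel₂

theorem const (c : Prop) : FODefinable (Φ := Φ) n fun _ _ _ _ => c := by
  by_cases hc : c
  · refine ⟨⊤, fun W M T xs => ?_⟩
    let := foStruct M T
    simp [hc]
  · refine ⟨⊥, fun W M T xs => ?_⟩
    let := foStruct M T
    simp [hc]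

theorem and (h : FODefinable n Q) (h' : FODefinable n Q') :
    FODefinable n fun W M T xs => Q W M T xs ∧ Q' W M T xs := by
  obtain ⟨χ, hχ⟩ := h
  obtain ⟨χ', hχ'⟩ := h'
  refine ⟨χ ⊓ χ', fun W M T xs => ?_⟩
  let := foStruct M T
  rw [BoundedFormula.realize_inf, hχ, hχ']

theorem iff (h : FODefinable n Q) (h' : FODefinable n Q') :
    FODefinable n fun W M T xs => (Q W M T xs ↔ Q' W M T xs) := by
  obtain ⟨χ, hχ⟩ := h
  obtain ⟨χ', hχ'⟩ := h'
  refine ⟨χ.iff χ', fun W M T xs => ?_⟩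
  let := foStruct M T
  rw [BoundedFormula.realize_iff, hχ, hχ']

theorem forall_finite {ι : Type*} [Finite ι]
    {Q : ι → ∀ W : Type, KripkeModel Φ W → Set W → (Fin n → W) → Prop}
    (h : ∀ a, FODefinable n (Q a)) : FODefinable n fun W M T xs => ∀ a, Q a W M T xs := by
  choose χ hχ using h
  refine ⟨BoundedFormula.iInf χ, fun W M T xs => ?_⟩
  let := foStruct M T
  rw [BoundedFormula.realize_iInf]
  exact forall_congr' fun a => hχ a W M T xs

theorem exists_finite {ι : Type*} [Finite ι]
    {Q : ι → ∀ W : Type, KripkeModel Φ W → Set W → (Fin n → W) → Prop}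
    (h : ∀ a, FODefinable n (Q a)) : FODefinable n fun W M T xs => ∃ a, Q a W M T xs := by
  choose χ hχ using h
  refine ⟨BoundedFormula.iSup χ, fun W M T xs => ?_⟩
  let := foStruct M T
  rw [BoundedFormula.realize_iSup]
  exact exists_congr fun a => hχ a W M T xs

theorem exists_world {Q : ∀ W : Type, KripkeModel Φ W → Set W → (Fin (n + 1) → W) → Prop}
    (h : FODefinable (n + 1) Q) :
    FODefinable n fun W M T xs => ∃ w, Q W M T (Fin.snoc xs w) := by
  obtain ⟨χ, hχ⟩ := h
  refine ⟨χ.ex, fun W M T xs => ?_⟩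
  let := foStruct M T
  rw [BoundedFormula.realize_ex]
  exact exists_congr fun w => hχ W M T _

end FODefinable

/-- The `k`-types over `Φ`: codes for the `k`-bisimilarity classes of pointed models. -/
def KType (Φ : Type) : ℕ → Type
  | 0 => Set Φ
  | k + 1 => Set Φ × Set (KType Φ k)

instance KType.finite [Finite Φ] (k : ℕ) : Finite (KType Φ k) := by
  induction k with
  | zero => exact inferInstanceAs (Finite (Set Φ))
  | succ k _ => exact inferInstanceAs (Finite (Set Φ × Set (KType Φ k)))

namespace KripkeModel

/-- The set of propositional variables true at a world. -/
def atoms (M : KripkeModel Φ W) (w : W) : Set Φ := {p | w ∈ M.val p}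

/-- The `k`-type of a world. -/
def kType (M : KripkeModel Φ W) : ∀ k, W → KType Φ k
  | 0, w => M.atoms w
  | k + 1, w => (M.atoms w, M.kType k '' {w' | M.R w w'})

end KripkeModel

theorem atoms_eq_atoms_iff {M₁ : KripkeModel Φ W₁} {M₂ : KripkeModel Φ W₂} {w₁ : W₁} {w₂ : W₂} :
    M₁.atoms w₁ = M₂.atoms w₂ ↔ ∀ p, w₁ ∈ M₁.val p ↔ w₂ ∈ M₂.val p :=
  Set.ext_iff

theorem kBisim_of_kType_eq {M₁ : KripkeModel Φ W₁} {M₂ : KripkeModel Φ W₂} {k : ℕ} {w₁ : W₁}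
    {w₂ : W₂} (h : M₁.kType k w₁ = M₂.kType k w₂) : kBisim M₁ M₂ k w₁ w₂ := by
  induction k generalizing w₁ w₂ with
  | zero => exact atoms_eq_atoms_iff.1 h
  | succ k ih =>
    obtain ⟨hatoms, hsucc⟩ := Prod.ext_iff.1 h
    simp only [KripkeModel.kType] at hatoms hsucc
    refine ⟨atoms_eq_atoms_iff.1 hatoms, fun w₁' hw => ?_, fun w₂' hw => ?_⟩
    · obtain ⟨w₂', hw', heq⟩ := hsucc ▸ Set.mem_image_of_mem (M₁.kType k) hw
      exact ⟨w₂', hw', ih heq.symm⟩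
    · obtain ⟨w₁', hw', heq⟩ := hsucc.symm ▸ Set.mem_image_of_mem (M₂.kType k) hw
      exact ⟨w₁', hw', ih heq⟩

theorem teamKBisim_of_image_kType_eq {M₁ : KripkeModel Φ W₁} {M₂ : KripkeModel Φ W₂} {k : ℕ}
    {T₁ : Set W₁} {T₂ : Set W₂} (h : M₁.kType k '' T₁ = M₂.kType k '' T₂) :
    teamKBisim M₁ M₂ k T₁ T₂ := by
  refine ⟨fun w₁ hw => ?_, fun w₂ hw => ?_⟩
  · obtain ⟨w₂, hw', heq⟩ := h ▸ Set.mem_image_of_mem (M₁.kType k) hw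
    exact ⟨w₂, hw', kBisim_of_kType_eq heq.symm⟩
  · obtain ⟨w₁, hw', heq⟩ := h.symm ▸ Set.mem_image_of_mem (M₂.kType k) hw
    exact ⟨w₁, hw', kBisim_of_kType_eq heq⟩

namespace FODefinable

theorem atoms_eq [Finite Φ] {n : ℕ} (i : Fin n) (S : Set Φ) :
    FODefinable n fun _ M _ xs => M.atoms (xs i) = S := by
  simp only [Set.ext_iff]
  exact forall_finite fun p => (val p i).iff (const (p ∈ S))

theorem kType_eq [Finite Φ] (k : ℕ) {n : ℕ} (i : Fin n) (τ : KType Φ k) :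
    FODefinable n fun _ M _ xs => M.kType k (xs i) = τ := by
  induction k generalizing n with
  | zero => exact atoms_eq i τ
  | succ k ih =>
    obtain ⟨S, A⟩ := τ
    have hA : FODefinable n fun _ M _ xs => M.kType k '' {w' | M.R (xs i) w'} = A := by
      simp only [Set.ext_iff]
      refine forall_finite fun σ => iff ?_ (const (σ ∈ A))
      simpa using ((rel i.castSucc (Fin.last n)).and (ih (Fin.last n) σ)).exists_world
    have h := (atoms_eq i S).and hA
    simp only [← Prod.mk.injEq] at h
    exact h

theorem image_kType_eq [Finite Φ] (k : ℕ) (A : Set (KType Φ k)) :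
    FODefinable 0 fun _ M T _ => M.kType k '' T = A := by
  simp only [Set.ext_iff]
  refine forall_finite fun σ => iff ?_ (const (σ ∈ A))
  simpa only [Set.mem_image, Fin.snoc_last] using
    ((team (Fin.last 0)).and (kType_eq k (Fin.last 0) σ)).exists_world

end FODefinable

/-- Every team property (on nonempty teams) that is invariant under `k`-bisimulation
for some `k` is expressible by a first-order sentence over the signature `σ_Φ`. -/
theorem kBisim_invariant_implies_FO_expressible [Finite Φ]
    (P : ∀ W : Type, KripkeModel Φ W → Set W → Prop) (k : ℕ)
    (hinv : ∀ (W₁ W₂ : Type) (M₁ : KripkeModel Φ W₁) (M₂ : KripkeModel Φ W₂)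
      (T₁ : Set W₁) (T₂ : Set W₂), T₁.Nonempty → T₂.Nonempty →
      P W₁ M₁ T₁ → teamKBisim M₁ M₂ k T₁ T₂ → P W₂ M₂ T₂) :
    ∃ ψ : (sigmaLang Φ).Sentence, ∀ (W : Type) (M : KripkeModel Φ W) (T : Set W),
      T.Nonempty → (P W M T ↔ foSat M T ψ) := by
  obtain ⟨ψ, hψ⟩ : FODefinable (Φ := Φ) 0 fun _ M T _ =>
      ∃ A : {A : Set (KType Φ k) // ∃ (W : Type) (M : KripkeModel Φ W) (T : Set W),
        T.Nonempty ∧ P W M T ∧ M.kType k '' T = A}, M.kType k '' T = A :=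
    FODefinable.exists_finite fun A => FODefinable.image_kType_eq k A.1
  refine ⟨ψ, fun W M T hT => Iff.trans ?_ (hψ W M T default).symm⟩
  constructor
  · exact fun hP => ⟨⟨_, W, M, T, hT, hP, rfl⟩, rfl⟩
  · rintro ⟨⟨A, W', M', T', hT', hP, hA⟩, hA'⟩
    exact hinv W' W M' M T' T hT' hT hP (teamKBisim_of_image_kType_eq (hA.trans hA'.symm))
end

section
/- There is a polynomial q such that for every n≥1 there exists an MTL formula φₙ over the propositional variables p₁,…,pₙ of length at most q(n) such that for every Kripke model M and every team T: M,T⊨φₙ if and only if M,T⊨dep(p₁,…,pₙ), i.e., any two worlds of T that agree on the values of p₁,…,p_{n-1} also agree on the value of pₙ. -/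
variable {Φ W W₁ W₂ : Type}

/-- The length (syntax tree size / number of symbol occurrences) of an MTL formula. -/
def MTLlen : MTLFormula Φ → ℕ
  | .pos _ => 1
  | .neg _ => 2
  | .cneg φ => MTLlen φ + 1
  | .and φ ψ => MTLlen φ + MTLlen ψ + 1
  | .or φ ψ => MTLlen φ + MTLlen ψ + 1
  | .dia φ => MTLlen φ + 1
  | .box φ => MTLlen φ + 1

/-- The set of propositional variables occurring in an MTL formula. -/
def MTLvars : MTLFormula Φ → Set Φ
  | .pos p => {p}
  | .neg p => {p}
  | .cneg φ => MTLvars φ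
  | .and φ ψ => MTLvars φ ∪ MTLvars ψ
  | .or φ ψ => MTLvars φ ∪ MTLvars ψ
  | .dia φ => MTLvars φ
  | .box φ => MTLvars φ

/-- The tautology `p ∨ ¬p`. -/
def MTLtop (p : Φ) : MTLFormula Φ := .or (.pos p) (.neg p)

/-- The constancy atom `dep(p)`, written as `∼(∼p ∧ ∼¬p)`. -/
def MTLconst (p : Φ) : MTLFormula Φ := .cneg (.and (.cneg (.pos p)) (.cneg (.neg p)))

/-- The conjunction of the constancy atoms of the variables `1, …, k`, and of `p ∨ ¬p`. -/
def MTLconstUpTo (p : ℕ) : ℕ → MTLFormula ℕ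
  | 0 => MTLtop p
  | k + 1 => .and (MTLconst (k + 1)) (MTLconstUpTo p k)

/-- The dependence atom `dep(1, …, n)`: no subteam is constant on `1, …, n - 1` but not on `n`. -/
def MTLdep (n : ℕ) : MTLFormula ℕ :=
  .cneg (.or (MTLtop n) (.and (MTLconstUpTo n (n - 1)) (.cneg (MTLconst n))))

theorem mtlTeamSat_top (M : KripkeModel Φ W) (p : Φ) (T : Set W) :
    MTLTeamSat M (MTLtop p) T :=
  ⟨T ∩ M.val p, T \ M.val p, (Set.inter_union_sdiff T (M.val p)).symm, Set.inter_subset_right,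
    Set.sdiff_inter_self⟩

theorem mtlTeamSat_const (M : KripkeModel Φ W) (p : Φ) (T : Set W) :
    MTLTeamSat M (MTLconst p) T ↔ ∀ w ∈ T, ∀ w' ∈ T, (w ∈ M.val p ↔ w' ∈ M.val p) := by
  simp only [MTLconst, MTLTeamSat, Set.subset_def, Set.eq_empty_iff_forall_notMem, Set.mem_inter_iff]
  grind

theorem mtlTeamSat_constUpTo (M : KripkeModel ℕ W) (p k : ℕ) (T : Set W) :
    MTLTeamSat M (MTLconstUpTo p k) T ↔
      ∀ i, 1 ≤ i → i ≤ k → ∀ w ∈ T, ∀ w' ∈ T, (w ∈ M.val i ↔ w' ∈ M.val i) := by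
  induction k with
  | zero => exact iff_of_true (mtlTeamSat_top M p T) (by omega)
  | succ k ih =>
    simp only [MTLconstUpTo, MTLTeamSat, mtlTeamSat_const, ih]
    constructor
    · rintro ⟨h, h'⟩ i hi hik
      rcases Nat.le_succ_iff.1 hik with hk | rfl
      exacts [h' i hi hk, h]
    · exact fun h => ⟨h _ (by omega) le_rfl, fun i hi hik => h i hi (by omega)⟩

theorem mtlTeamSat_dep (M : KripkeModel ℕ W) (n : ℕ) (T : Set W) :
    MTLTeamSat M (MTLdep n) T ↔
      ∀ w ∈ T, ∀ w' ∈ T,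
        (∀ i, 1 ≤ i → i ≤ n - 1 → (w ∈ M.val i ↔ w' ∈ M.val i)) →
        (w ∈ M.val n ↔ w' ∈ M.val n) := by
  simp only [MTLdep, MTLTeamSat, mtlTeamSat_top, mtlTeamSat_constUpTo, mtlTeamSat_const, true_and]
  constructor
  · intro h w hw w' hw' hagree
    by_contra hn
    refine h ⟨T, {w, w'}, ?_, ?_, fun hc => hn (hc w (by simp) w' (by simp))⟩
    · exact (Set.union_eq_self_of_subset_right (Set.pair_subset hw hw')).symm
    · rintro i hi hin _ (rfl | rfl) _ (rfl | rfl)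
      exacts [Iff.rfl, hagree i hi hin, (hagree i hi hin).symm, Iff.rfl]
  · rintro h ⟨T₁, T₂, rfl, hc, hn⟩
    exact hn fun w hw w' hw' => h w (.inr hw) w' (.inr hw') fun i hi hin => hc i hi hin w hw w' hw'

theorem mtlLen_constUpTo (p k : ℕ) : MTLlen (MTLconstUpTo p k) = 8 * k + 4 := by
  induction k with
  | zero => rfl
  | succ k ih =>
    simp only [MTLconstUpTo, MTLlen, MTLconst, ih]
    omega

theorem mtlVars_constUpTo (p k : ℕ) :
    MTLvars (MTLconstUpTo p k) ⊆ {i | i ≤ max p k} := by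
  induction k with
  | zero => simp [MTLconstUpTo, MTLtop, MTLvars]
  | succ k ih =>
    simp only [MTLconstUpTo, MTLconst, MTLvars, Set.union_self]
    refine Set.union_subset (by simp) (ih.trans fun i hi => ?_)
    simp only [Set.mem_ofPred_eq] at hi ⊢
    omega

theorem mtlVars_dep (n : ℕ) : MTLvars (MTLdep n) ⊆ {i | i ≤ n} := by
  simp only [MTLdep, MTLtop, MTLconst, MTLvars, Set.union_self]
  refine Set.union_subset (by simp) (Set.union_subset ?_ (by simp))
  simpa using mtlVars_constUpTo n (n - 1)

/-- The dependence atom `dep(p₁,…,pₙ)` can be expressed in MTL by formulas of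
polynomial length: there is a polynomial `q` such that for each `n ≥ 1` there is an
MTL formula over the variables `p₀,…,pₙ` (coded as `0,…,n : ℕ`) of length at most
`q(n)` which is satisfied by a team `T` iff any two worlds of `T` agreeing on
`p₁,…,p_{n-1}` agree on `pₙ`. -/
theorem dep_atom_poly_MTL :
    ∃ q : Polynomial ℕ, ∀ n : ℕ, 1 ≤ n →
      ∃ φ : MTLFormula ℕ, MTLlen φ ≤ q.eval n ∧ MTLvars φ ⊆ {i | i ≤ n} ∧
        ∀ (W : Type) (M : KripkeModel ℕ W) (T : Set W),
          MTLTeamSat M φ T ↔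
            ∀ w ∈ T, ∀ w' ∈ T,
              (∀ i, 1 ≤ i → i ≤ n - 1 → (w ∈ M.val i ↔ w' ∈ M.val i)) →
              (w ∈ M.val n ↔ w' ∈ M.val n) := by
  refine ⟨8 * .X + 19, fun n _ => ⟨MTLdep n, ?_, mtlVars_dep n, fun W M T => mtlTeamSat_dep M n T⟩⟩
  simp only [MTLdep, MTLtop, MTLconst, MTLlen, mtlLen_constUpTo, Polynomial.eval_add,
    Polynomial.eval_mul, Polynomial.eval_X, Polynomial.eval_ofNat]
  omega
end

section
/- Let M=(W,R,π) be a Kripke model with empty accessibility relation R=∅, and let T ⊆ W be a team. Then for every EMIL(⋁) formula φ: if M,T⊨φ, then M,{w}⊨φ for every w∈T. -/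
variable {Φ W W₁ W₂ : Type}

/-- EMIL(⋁) formulas: ML extended with extended independence atoms
`P̄ ⊥_{R̄} Q̄` (finite sets of ML formulas given as lists) and classical
disjunction `⋁`. -/
inductive EMILFormula (Φ : Type) : Type
  | pos : Φ → EMILFormula Φ
  | neg : Φ → EMILFormula Φ
  | and : EMILFormula Φ → EMILFormula Φ → EMILFormula Φ
  | or  : EMILFormula Φ → EMILFormula Φ → EMILFormula Φ
  | dia : EMILFormula Φ → EMILFormula Φ
  | box : EMILFormula Φ → EMILFormula Φ
  | indep : List (MLFormula Φ) → List (MLFormula Φ) → List (MLFormula Φ) → EMILFormula Φ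
  | cor : EMILFormula Φ → EMILFormula Φ → EMILFormula Φ

/-- Team semantics for EMIL(⋁).  In `indep Ps Rs Qs`, the middle list `Rs` is the
subscript of the independence atom `Ps ⊥_{Rs} Qs`. -/
def EMILSat (M : KripkeModel Φ W) : EMILFormula Φ → Set W → Prop
  | .pos p, T => T ⊆ M.val p
  | .neg p, T => T ∩ M.val p = ∅
  | .and φ ψ, T => EMILSat M φ T ∧ EMILSat M ψ T
  | .or φ ψ, T => ∃ T₁ T₂, T = T₁ ∪ T₂ ∧ EMILSat M φ T₁ ∧ EMILSat M ψ T₂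
  | .dia φ, T => ∃ T', EMILSat M φ T' ∧ (∀ w ∈ T, ∃ w' ∈ T', M.R w w') ∧
      (∀ w' ∈ T', ∃ w ∈ T, M.R w w')
  | .box φ, T => EMILSat M φ {w' | ∃ w ∈ T, M.R w w'}
  | .indep Ps Rs Qs, T => ∀ w ∈ T, ∀ w' ∈ T,
      (∀ χ ∈ Rs, (MLTeamSat M χ {w} ↔ MLTeamSat M χ {w'})) →
      ∃ w'' ∈ T, (∀ χ ∈ Ps, (MLTeamSat M χ {w''} ↔ MLTeamSat M χ {w})) ∧
        (∀ χ ∈ Qs, (MLTeamSat M χ {w''} ↔ MLTeamSat M χ {w'})) ∧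
        (∀ χ ∈ Rs, (MLTeamSat M χ {w''} ↔ MLTeamSat M χ {w}))
  | .cor φ ψ, T => EMILSat M φ T ∨ EMILSat M ψ T

/-- Every EMIL(⋁) formula is satisfied by the empty team. -/
theorem EMILSat_empty (M : KripkeModel Φ W) (φ : EMILFormula Φ) : EMILSat M φ ∅ := by
  induction φ with
  | pos p => exact Set.empty_subset _
  | neg p => exact Set.empty_inter _
  | and φ ψ ihφ ihψ => exact ⟨ihφ, ihψ⟩
  | or φ ψ ihφ ihψ => exact ⟨∅, ∅, (Set.union_empty _).symm, ihφ, ihψ⟩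
  | dia φ ih => exact ⟨∅, ih, by simp, by simp⟩
  | box φ ih => simpa [EMILSat] using ih
  | indep Ps Rs Qs => simp [EMILSat]
  | cor φ ψ ihφ ihψ => exact Or.inl ihφ

/-- Over a Kripke model with empty accessibility relation, every EMIL(⋁) formula
satisfied by a team is satisfied by each of its singleton subteams. -/
theorem emil_empty_relation_singleton (M : KripkeModel Φ W)
    (hR : ∀ w w', ¬ M.R w w') (T : Set W) (φ : EMILFormula Φ)
    (h : EMILSat M φ T) : ∀ w ∈ T, EMILSat M φ {w} := by
  induction φ generalizing T with
  | pos p => exact fun w hw => Set.singleton_subset_iff.mpr (h hw)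
  | neg p =>
    intro w hw
    exact Set.singleton_inter_eq_empty.mpr fun hp => Set.eq_empty_iff_forall_notMem.mp h w ⟨hw, hp⟩
  | and φ ψ ihφ ihψ => exact fun w hw => ⟨ihφ T h.1 w hw, ihψ T h.2 w hw⟩
  | or φ ψ ihφ ihψ =>
    obtain ⟨T₁, T₂, rfl, h₁, h₂⟩ := h
    rintro w (hw | hw)
    · exact ⟨{w}, ∅, (Set.union_empty _).symm, ihφ T₁ h₁ w hw, EMILSat_empty M ψ⟩
    · exact ⟨∅, {w}, (Set.empty_union _).symm, EMILSat_empty M φ, ihψ T₂ h₂ w hw⟩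
  | dia φ ih =>
    intro w hw
    obtain ⟨T', -, hT, -⟩ := h
    obtain ⟨w', -, hw'⟩ := hT w hw
    exact absurd hw' (hR w w')
  | box φ ih =>
    intro w hw
    simpa [EMILSat, hR] using EMILSat_empty M φ
  | indep Ps Rs Qs =>
    rintro w - _ rfl _ rfl -
    exact ⟨_, rfl, fun _ _ => Iff.rfl, fun _ _ => Iff.rfl, fun _ _ => Iff.rfl⟩
  | cor φ ψ ihφ ihψ =>
    exact fun w hw => h.imp (fun h => ihφ T h w hw) (fun h => ihψ T h w hw)
end

section
/- Let p be a propositional variable. There is no EMIL(⋁) formula φ such that for every Kripke model M and every team T of M: M,T⊨φ if and only if there exists a world w∈T with w∈π(p). Hence the team property expressed by the MTL formula Ep is not expressible in EMIL(⋁), and EMIL(⋁) is strictly less expressive than MTL. -/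
variable {Φ W W₁ W₂ : Type}

/-- The team property expressed by the MTL formula `E p` (some world of the team
satisfies `p`) is not expressible in EMIL(⋁); hence EMIL(⋁) is strictly less
expressive than MTL. -/
theorem Ep_not_expressible_in_emil (p : Φ) :
    ¬ ∃ φ : EMILFormula Φ, ∀ (W : Type) (M : KripkeModel Φ W) (T : Set W),
        EMILSat M φ T ↔ ∃ w ∈ T, w ∈ M.val p := by
  rintro ⟨φ, hφ⟩
  let M : KripkeModel Φ Unit := ⟨inferInstance, fun _ _ => False, fun _ => ∅⟩
  obtain ⟨_, hw, _⟩ := (hφ Unit M ∅).mp (EMILSat_empty M φ)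
  exact hw
end

section
/- For all propositional variables p₁,…,pₙ, every Kripke model M, and every team T: M,T⊨dep(p₁,…,pₙ) (i.e., any two worlds of T agreeing on p₁,…,p_{n-1} agree on pₙ) if and only if M,T⊨{pₙ} ⊥_{{p₁,…,p_{n-1}}} {pₙ}, the extended independence atom with P̄=Q̄={pₙ} and R̄={p₁,…,p_{n-1}}. Hence dependence atoms are expressible by independence atoms. -/
variable {Φ W W₁ W₂ : Type}

/-- The dependence atom `dep(p₁,…,pₙ)` is equivalent to the independence atom
`{pₙ} ⊥_{{p₁,…,p_{n-1}}} {pₙ}`: a team satisfies the latter iff any two of its worlds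
agreeing on `p₁,…,p_{n-1}` agree on `pₙ`.  (Variables are coded as natural numbers.) -/
theorem dep_eq_indep (n : ℕ) (hn : 1 ≤ n) (W : Type) (M : KripkeModel ℕ W) (T : Set W) :
    (∀ w ∈ T, ∀ w' ∈ T,
        (∀ i, 1 ≤ i → i ≤ n - 1 → (w ∈ M.val i ↔ w' ∈ M.val i)) →
        (w ∈ M.val n ↔ w' ∈ M.val n)) ↔
    EMILSat M (EMILFormula.indep [MLFormula.pos n]
        ((List.range' 1 (n - 1)).map MLFormula.pos) [MLFormula.pos n]) T := by
  simp only [EMILSat, List.forall_mem_map, List.mem_range'_1, List.forall_mem_singleton,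
    MLTeamSat, Set.singleton_subset_iff]
  constructor
  · intro h w hw w' hw' hR
    have hn' := h w hw w' hw' fun i h1 h2 => hR i ⟨h1, by omega⟩
    exact ⟨w, hw, Iff.rfl, hn', fun _ _ => Iff.rfl⟩
  · intro h w hw w' hw' hR
    obtain ⟨v, -, hvw, hvw', -⟩ := h w hw w' hw' fun i hi => hR i hi.1 (by omega)
    exact hvw.symm.trans hvw'
end

section
/- EMINCL is union closed: for every EMINCL formula φ, every Kripke model M, and all teams T₁, T₂ of M, if M,T₁⊨φ and M,T₂⊨φ, then M,T₁∪T₂⊨φ. -/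
variable {Φ W W₁ W₂ : Type}

/-- EMINCL formulas: ML extended with extended inclusion atoms
`(φ₁,…,φₙ) ⊆ (ψ₁,…,ψₙ)`, given as a list of pairs `(φᵢ, ψᵢ)` of ML formulas. -/
inductive EMINCLFormula (Φ : Type) : Type
  | pos : Φ → EMINCLFormula Φ
  | neg : Φ → EMINCLFormula Φ
  | and : EMINCLFormula Φ → EMINCLFormula Φ → EMINCLFormula Φ
  | or  : EMINCLFormula Φ → EMINCLFormula Φ → EMINCLFormula Φ
  | dia : EMINCLFormula Φ → EMINCLFormula Φ
  | box : EMINCLFormula Φ → EMINCLFormula Φ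
  | incl : List (MLFormula Φ × MLFormula Φ) → EMINCLFormula Φ

/-- Team semantics for EMINCL. -/
def EMINCLSat (M : KripkeModel Φ W) : EMINCLFormula Φ → Set W → Prop
  | .pos p, T => T ⊆ M.val p
  | .neg p, T => T ∩ M.val p = ∅
  | .and φ ψ, T => EMINCLSat M φ T ∧ EMINCLSat M ψ T
  | .or φ ψ, T => ∃ T₁ T₂, T = T₁ ∪ T₂ ∧ EMINCLSat M φ T₁ ∧ EMINCLSat M ψ T₂
  | .dia φ, T => ∃ T', EMINCLSat M φ T' ∧ (∀ w ∈ T, ∃ w' ∈ T', M.R w w') ∧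
      (∀ w' ∈ T', ∃ w ∈ T, M.R w w')
  | .box φ, T => EMINCLSat M φ {w' | ∃ w ∈ T, M.R w w'}
  | .incl ps, T => ∀ w ∈ T, ∃ w' ∈ T,
      ∀ pr ∈ ps, (MLTeamSat M pr.1 {w} ↔ MLTeamSat M pr.2 {w'})

/-- EMINCL is union closed: if two teams satisfy an EMINCL formula, so does their
union. -/
theorem emincl_union_closed (M : KripkeModel Φ W) (φ : EMINCLFormula Φ)
    (T₁ T₂ : Set W) (h₁ : EMINCLSat M φ T₁) (h₂ : EMINCLSat M φ T₂) :
    EMINCLSat M φ (T₁ ∪ T₂) := by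
  induction φ generalizing T₁ T₂ with
  | pos p => exact Set.union_subset h₁ h₂
  | neg p =>
    simp only [EMINCLSat] at h₁ h₂ ⊢
    rw [Set.union_inter_distrib_right, h₁, h₂, Set.union_empty]
  | and φ ψ ihφ ihψ => exact ⟨ihφ T₁ T₂ h₁.1 h₂.1, ihψ T₁ T₂ h₁.2 h₂.2⟩
  | or φ ψ ihφ ihψ =>
    obtain ⟨A₁, B₁, rfl, hA₁, hB₁⟩ := h₁
    obtain ⟨A₂, B₂, rfl, hA₂, hB₂⟩ := h₂
    exact ⟨A₁ ∪ A₂, B₁ ∪ B₂, Set.union_union_union_comm A₁ B₁ A₂ B₂,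
      ihφ A₁ A₂ hA₁ hA₂, ihψ B₁ B₂ hB₁ hB₂⟩
  | dia φ ih =>
    obtain ⟨S₁, hS₁, forth₁, back₁⟩ := h₁
    obtain ⟨S₂, hS₂, forth₂, back₂⟩ := h₂
    refine ⟨S₁ ∪ S₂, ih S₁ S₂ hS₁ hS₂, ?_, ?_⟩
    · rintro w (hw | hw)
      · obtain ⟨v, hv, hR⟩ := forth₁ w hw
        exact ⟨v, Or.inl hv, hR⟩
      · obtain ⟨v, hv, hR⟩ := forth₂ w hw
        exact ⟨v, Or.inr hv, hR⟩
    · rintro v (hv | hv)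
      · obtain ⟨w, hw, hR⟩ := back₁ v hv
        exact ⟨w, Or.inl hw, hR⟩
      · obtain ⟨w, hw, hR⟩ := back₂ v hv
        exact ⟨w, Or.inr hw, hR⟩
  | box φ ih =>
    have h := ih _ _ h₁ h₂
    have image_union : {v | ∃ w ∈ T₁, M.R w v} ∪ {v | ∃ w ∈ T₂, M.R w v} =
        {v | ∃ w ∈ T₁ ∪ T₂, M.R w v} := by
      ext v
      simp only [Set.mem_union, Set.mem_ofPred_eq, or_and_right, exists_or]
    rwa [image_union] at h
  | incl ps =>
    rintro w (hw | hw)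
    · obtain ⟨v, hv, h⟩ := h₁ w hw
      exact ⟨v, Or.inl hv, h⟩
    · obtain ⟨v, hv, h⟩ := h₂ w hw
      exact ⟨v, Or.inr hv, h⟩
end

section
/- Let p₁ and p₂ be distinct propositional variables. There is no EMINCL formula φ such that for every Kripke model M and every team T of M: M,T⊨φ if and only if there is exactly one i∈{1,2} for which some world w∈T has w∈π(pᵢ). Hence EMINCL is strictly less expressive than MTL. -/
variable {Φ W W₁ W₂ : Type}

/-- EMINCL formulas are closed under unions of teams. -/
theorem EMINCLSat.union {M : KripkeModel Φ W} {φ : EMINCLFormula Φ} {S T : Set W}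
    (hS : EMINCLSat M φ S) (hT : EMINCLSat M φ T) : EMINCLSat M φ (S ∪ T) := by
  induction φ generalizing S T with
  | pos p => exact Set.union_subset hS hT
  | neg p =>
    simp only [EMINCLSat] at *
    rw [Set.union_inter_distrib_right, hS, hT, Set.union_empty]
  | and φ ψ ihφ ihψ => exact ⟨ihφ hS.1 hT.1, ihψ hS.2 hT.2⟩
  | or φ ψ ihφ ihψ =>
    obtain ⟨S₁, S₂, rfl, hS₁, hS₂⟩ := hS
    obtain ⟨T₁, T₂, rfl, hT₁, hT₂⟩ := hT
    exact ⟨S₁ ∪ T₁, S₂ ∪ T₂, Set.union_union_union_comm .., ihφ hS₁ hT₁, ihψ hS₂ hT₂⟩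
  | dia φ ih =>
    obtain ⟨S', hS', hS₁, hS₂⟩ := hS
    obtain ⟨T', hT', hT₁, hT₂⟩ := hT
    refine ⟨S' ∪ T', ih hS' hT', ?_, ?_⟩
    · rintro w (hw | hw)
      · exact (hS₁ w hw).imp fun _ h => ⟨Or.inl h.1, h.2⟩
      · exact (hT₁ w hw).imp fun _ h => ⟨Or.inr h.1, h.2⟩
    · rintro w (hw | hw)
      · exact (hS₂ w hw).imp fun _ h => ⟨Or.inl h.1, h.2⟩
      · exact (hT₂ w hw).imp fun _ h => ⟨Or.inr h.1, h.2⟩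
  | box φ ih =>
    have hU : {w' | ∃ w ∈ S ∪ T, M.R w w'} =
        {w' | ∃ w ∈ S, M.R w w'} ∪ {w' | ∃ w ∈ T, M.R w w'} := by
      ext w'
      simp only [Set.mem_union, Set.mem_ofPred_eq, or_and_right, exists_or]
    simp only [EMINCLSat] at *
    rw [hU]
    exact ih hS hT
  | incl ps =>
    rintro w (hw | hw)
    · exact (hS w hw).imp fun _ h => ⟨Or.inl h.1, h.2⟩
    · exact (hT w hw).imp fun _ h => ⟨Or.inr h.1, h.2⟩

/-- There is no EMINCL formula expressing that exactly one of the variables `p₁, p₂`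
is satisfied in some world of the team; hence EMINCL is strictly less expressive
than MTL. -/
theorem exactly_one_not_expressible_in_emincl (p₁ p₂ : Φ) (hp : p₁ ≠ p₂) :
    ¬ ∃ φ : EMINCLFormula Φ, ∀ (W : Type) (M : KripkeModel Φ W) (T : Set W),
        EMINCLSat M φ T ↔ Xor' (∃ w ∈ T, w ∈ M.val p₁) (∃ w ∈ T, w ∈ M.val p₂) := by
  rintro ⟨φ, hφ⟩
  let M : KripkeModel Φ Bool :=
    { nonempty := ⟨true⟩
      R := fun _ _ => False
      val := fun p => {w | p = if w then p₁ else p₂} }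
  have h₁ : EMINCLSat M φ {true} := by
    rw [hφ]
    simp [M, Xor', hp.symm]
  have h₂ : EMINCLSat M φ {false} := by
    rw [hφ]
    simp [M, Xor', hp]
  have h := (hφ Bool M _).1 (h₁.union h₂)
  simp [M, Xor'] at h
end
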